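/- arXiv:1602.05717 — 3 statements merged into one kernel-verified Lean document; each statement's English description precedes it below -/
import Mathlib

section
/- Let N > 0, let 0 < a < N and 2/(N+a) < b ≤ 4/(N+3a), and let g ∈ V_{N,a}. Then for every x ∈ [-a/2, 0] one has G_{23}(x) ≥ 0, and G_{23}(x) = 0 holds if and only if g(x - 1/b - a) = 0 and g(x - 1/b) = 0. -/
open Set

noncomputable section

/-- Second-order difference `Δ²_a f (x) = f x - 2 f (x-a) + f (x-2a)`. -/
def Delta2 (a : ℝ) (f : ℝ → ℝ) (x : ℝ) : ℝ := f x - 2 * f (x - a) + f (x - 2 * a)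

/-- Membership in the class `V_{N,a}` of the paper: `f` is continuous, has support
exactly `[-N/2, N/2]`, is symmetric (A1), strictly increasing on `[-N/2,0]` (A2),
and satisfies the second-order difference condition (A3). -/
def memV (N a : ℝ) (f : ℝ → ℝ) : Prop :=
  Continuous f ∧
  tsupport f = Set.Icc (-(N / 2)) (N / 2) ∧
  (∀ x, f (-x) = f x) ∧
  StrictMonoOn f (Set.Icc (-(N / 2)) 0) ∧
  (a < N / 3 → ∀ x ∈ Set.Icc (-(N / 2)) (-(N / 4) + 3 * a / 4), 0 ≤ Delta2 a f x) ∧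
  (N / 3 ≤ a → (∀ x ∈ Set.Icc (-(N / 2)) 0, 0 ≤ Delta2 a f x) ∧
    0 ≤ Delta2 a f (-(N / 4) + 3 * a / 4))

/-- The minor `G₂₁` of the matrix `G(x)`. -/
def G21 (g : ℝ → ℝ) (a b x : ℝ) : ℝ :=
  g (x + 1 / b) * g (x - 1 / b + a) - g (x + 1 / b + a) * g (x - 1 / b)

/-- The minor `G₂₂` of the matrix `G(x)`. -/
def G22 (g : ℝ → ℝ) (a b x : ℝ) : ℝ :=
  g (x + 1 / b - a) * g (x - 1 / b + a) - g (x + 1 / b + a) * g (x - 1 / b - a)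

/-- The minor `G₂₃` of the matrix `G(x)`. -/
def G23 (g : ℝ → ℝ) (a b x : ℝ) : ℝ :=
  g (x + 1 / b - a) * g (x - 1 / b) - g (x + 1 / b) * g (x - 1 / b - a)

namespace memV

variable {N a : ℝ} {g : ℝ → ℝ}

theorem eq_zero_of_le (hg : memV N a g) {y : ℝ} (hy : y ≤ -(N / 2)) : g y = 0 := by
  obtain ⟨hc, hs, -⟩ := hg
  have hlt : Set.Iio (-(N / 2)) ⊆ {z | g z = 0} := fun z hz =>
    image_eq_zero_of_notMem_tsupport (by rw [hs]; exact fun h => absurd h.1 (not_le.2 hz))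
  have hcl := closure_minimal hlt (isClosed_eq hc continuous_const)
  rw [closure_Iio] at hcl
  exact hcl hy

theorem pos_of_lt (hg : memV N a g) {y : ℝ} (hy : -(N / 2) < y) (hy0 : y ≤ 0) : 0 < g y := by
  rw [← hg.eq_zero_of_le le_rfl]
  exact hg.2.2.2.1 ⟨le_rfl, hy.le.trans hy0⟩ ⟨hy.le, hy0⟩ hy

theorem nonneg_of_nonpos (hg : memV N a g) {y : ℝ} (hy0 : y ≤ 0) : 0 ≤ g y := by
  rcases le_or_gt y (-(N / 2)) with h | h
  · exact (hg.eq_zero_of_le h).ge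
  · exact (hg.pos_of_lt h hy0).le

theorem mono_of_nonpos (hg : memV N a g) {y z : ℝ} (hyz : y ≤ z) (hz : z ≤ 0) : g y ≤ g z := by
  rcases le_or_gt y (-(N / 2)) with h | h
  · rw [hg.eq_zero_of_le h]
    exact hg.nonneg_of_nonpos hz
  · exact hg.2.2.2.1.monotoneOn ⟨h.le, hyz.trans hz⟩ ⟨h.le.trans hyz, hz⟩ hyz

theorem apply_neg_abs (hg : memV N a g) (y : ℝ) : g (-|y|) = g y := by
  rw [hg.2.2.1]
  rcases abs_choice y with h | h <;> rw [h]
  exact hg.2.2.1 y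

theorem pos_of_abs_lt (hg : memV N a g) {y : ℝ} (hy : |y| < N / 2) : 0 < g y := by
  rw [← hg.apply_neg_abs]
  exact hg.pos_of_lt (by linarith) (neg_nonpos.2 (abs_nonneg y))

theorem anti_abs (hg : memV N a g) {y z : ℝ} (h : |y| ≤ |z|) : g z ≤ g y := by
  rw [← hg.apply_neg_abs y, ← hg.apply_neg_abs z]
  exact hg.mono_of_nonpos (neg_le_neg h) (neg_nonpos.2 (abs_nonneg y))

end memV

theorem stmt5 (N a b : ℝ) (hN : 0 < N) (ha : 0 < a) (haN : a < N)
    (hb1 : 2 / (N + a) < b) (hb2 : b ≤ 4 / (N + 3 * a))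
    (g : ℝ → ℝ) (hg : memV N a g) :
    ∀ x ∈ Set.Icc (-(a / 2)) 0,
      0 ≤ G23 g a b x ∧
        (G23 g a b x = 0 ↔ g (x - 1 / b - a) = 0 ∧ g (x - 1 / b) = 0) := by
  rintro x ⟨hx1, hx2⟩
  have hb : 0 < b := lt_trans (by positivity) hb1
  have hl1 : 1 / b < (N + a) / 2 := by
    rw [div_lt_iff₀ (by positivity)] at hb1
    rw [div_lt_iff₀ hb]
    linarith
  have hl2 : (N + 3 * a) / 4 ≤ 1 / b := by
    rw [le_div_iff₀ (by positivity)] at hb2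
    rw [le_div_iff₀ hb]
    linarith
  unfold G23
  generalize 1 / b = l at hl1 hl2 ⊢
  have hpos : 0 < g (x + l - a) := hg.pos_of_abs_lt (abs_lt.2 ⟨by linarith, by linarith⟩)
  have hle : g (x + l) ≤ g (x + l - a) := by
    refine hg.anti_abs (abs_le.2 ?_)
    rw [abs_of_nonneg (by linarith : 0 ≤ x + l)]
    constructor <;> linarith
  rcases le_or_gt (x - l - a) (-(N / 2)) with h | h
  · have hp : 0 ≤ g (x - l) := hg.nonneg_of_nonpos (by linarith)
    simp only [hg.eq_zero_of_le h, mul_zero, sub_zero, true_and, mul_eq_zero, hpos.ne', false_or]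
    exact ⟨mul_nonneg hpos.le hp, trivial⟩
  · have hq : 0 < g (x - l - a) := hg.pos_of_lt h (by linarith)
    have hlt : g (x - l - a) < g (x - l) :=
      hg.2.2.2.1 ⟨h.le, by linarith⟩ ⟨by linarith, by linarith⟩ (by linarith)
    have hG : 0 < g (x + l - a) * g (x - l) - g (x + l) * g (x - l - a) :=
      sub_pos.2 ((mul_le_mul_of_nonneg_right hle hq.le).trans_lt (mul_lt_mul_of_pos_left hlt hpos))
    exact ⟨hG.le, fun h0 => absurd h0 hG.ne', fun h0 => absurd h0.1 hq.ne'⟩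
end
end

section
/- Let N > 0, let 0 < a < N and 2/(N+a) < b ≤ 4/(N+3a), and let g ∈ V_{N,a}. Then for every x ∈ [-a/2, 0] one has G_{22}(x) ≥ G_{21}(x) + G_{23}(x). -/
open Set

noncomputable section

theorem memV.eq_zero_of_le_s6 {N a : ℝ} {g : ℝ → ℝ} (hg : memV N a g) {x : ℝ}
    (hx : x ≤ -(N / 2)) : g x = 0 := by
  obtain ⟨hc, hs, -⟩ := hg
  have hsub : Iio (-(N / 2)) ⊆ {y | g y = 0} := fun y hy =>
    image_eq_zero_of_notMem_tsupport fun h => by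
      rw [hs] at h
      exact absurd h.1 (not_le.2 hy)
  have hcl := closure_minimal hsub (isClosed_eq hc continuous_const)
  rw [closure_Iio] at hcl
  exact hcl hx

theorem memV.monotoneOn {N a : ℝ} {g : ℝ → ℝ} (hN : 0 < N) (hg : memV N a g) :
    MonotoneOn g (Iic 0) := by
  have hm := hg.2.2.2.1.monotoneOn
  intro x hx y hy hxy
  rw [mem_Iic] at hx hy
  rcases le_total y (-(N / 2)) with h | h
  · rw [hg.eq_zero_of_le_s6 h, hg.eq_zero_of_le_s6 (hxy.trans h)]
  rcases le_total x (-(N / 2)) with h' | h'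
  · rw [hg.eq_zero_of_le_s6 h', ← hg.eq_zero_of_le_s6 le_rfl]
    exact hm ⟨le_rfl, by linarith⟩ ⟨h, hy⟩ h
  · exact hm ⟨h', hx⟩ ⟨h, hy⟩ hxy

theorem memV.delta2_nonneg {N a : ℝ} {g : ℝ → ℝ} (hN : 0 < N)
    (haN : a < N) (hg : memV N a g) {x : ℝ} (hx : -(N / 2) ≤ x)
    (hx' : x ≤ -(N / 4) + 3 * a / 4) : 0 ≤ Delta2 a g x := by
  have hmono := hg.monotoneOn hN
  have heven := hg.2.2.1
  rcases lt_or_ge a (N / 3) with h | h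
  · exact hg.2.2.2.2.1 h x ⟨hx, hx'⟩
  obtain ⟨hneg, hend⟩ := hg.2.2.2.2.2 h
  rcases le_or_gt x 0 with h0 | h0
  · exact hneg x ⟨hx, h0⟩
  have h1 : g (-(N / 4) + 3 * a / 4) ≤ g x := by
    rw [← heven x, ← heven (-(N / 4) + 3 * a / 4)]
    exact hmono (mem_Iic.2 (by linarith)) (mem_Iic.2 (by linarith)) (by linarith)
  have h2 : g (x - a) ≤ g (-(N / 4) + 3 * a / 4 - a) :=
    hmono (mem_Iic.2 (by linarith)) (mem_Iic.2 (by linarith)) (by linarith)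
  have h3 : g (x - 2 * a) = 0 := hg.eq_zero_of_le_s6 (by linarith)
  have h4 : g (-(N / 4) + 3 * a / 4 - 2 * a) = 0 := hg.eq_zero_of_le_s6 (by linarith)
  unfold Delta2 at hend ⊢
  linarith

theorem stmt6 (N a b : ℝ) (hN : 0 < N) (ha : 0 < a) (haN : a < N)
    (hb1 : 2 / (N + a) < b) (hb2 : b ≤ 4 / (N + 3 * a))
    (g : ℝ → ℝ) (hg : memV N a g) :
    ∀ x ∈ Set.Icc (-(a / 2)) 0, G21 g a b x + G23 g a b x ≤ G22 g a b x := by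
  rintro x ⟨hx1, hx2⟩
  have hb : 0 < b := lt_trans (by positivity) hb1
  have hlow : (N + 3 * a) / 4 ≤ 1 / b := by
    rw [le_div_iff₀ (by positivity)] at hb2
    rw [le_div_iff₀ hb]
    linarith
  have hupp : 1 / b < (N + a) / 2 := by
    rw [div_lt_iff₀ (by positivity)] at hb1
    rw [div_lt_iff₀ hb]
    linarith
  unfold G21 G22 G23
  generalize 1 / b = h at hlow hupp
  have hmono := hg.monotoneOn hN
  have heven := hg.2.2.1
  have hq : g (x - h - a) ≤ g (x - h) :=
    hmono (mem_Iic.2 (by linarith)) (mem_Iic.2 (by linarith)) (by linarith)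
  have hs : g (x + h + a) ≤ g (x + h) := by
    rw [← heven (x + h), ← heven (x + h + a)]
    exact hmono (mem_Iic.2 (by linarith)) (mem_Iic.2 (by linarith)) (by linarith)
  have hpq : 0 ≤ g (x - h + a) - 2 * g (x - h) + g (x - h - a) := by
    have := hg.delta2_nonneg hN haN (x := x - h + a) (by linarith) (by linarith)
    rwa [Delta2, show x - h + a - a = x - h by ring,
      show x - h + a - 2 * a = x - h - a by ring] at this
  have hrs : 0 ≤ g (x + h - a) - 2 * g (x + h) + g (x + h + a) := by
    have := hg.delta2_nonneg hN haN (x := -(x + h - a)) (by linarith) (by linarith)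
    rwa [Delta2, show -(x + h - a) - a = -(x + h) by ring,
      show -(x + h - a) - 2 * a = -(x + h + a) by ring, heven, heven, heven] at this
  have hprod : (g (x - h) - g (x - h - a)) * (g (x + h) - g (x + h + a)) ≤
      (g (x - h + a) - g (x - h)) * (g (x + h - a) - g (x + h)) :=
    mul_le_mul (by linarith) (by linarith) (by linarith) (by linarith)
  linarith
end
end

section
/- Let N ≥ √(12/5) and define p_N(x) = 1/(1+x²) - 1/(1+(N/2)²) for x ∈ [-N/2, N/2] and p_N(x) = 0 otherwise. Then for every a with N/3 ≤ a < 3N/7 and every x ∈ [-N/2, -N/4 + 3a/4] one has Δ²_a p_N(x) ≥ 0; consequently p_N ∈ V_{N,a} for every a ∈ [N/3, 3N/7). -/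
open Set

noncomputable section

/-- `p_N(x) = 1/(1+x²) - 1/(1+(N/2)²)` on `[-N/2, N/2]`, extended by zero. -/
def pN (N : ℝ) (x : ℝ) : ℝ :=
  if x ∈ Set.Icc (-(N / 2)) (N / 2) then 1 / (1 + x ^ 2) - 1 / (1 + (N / 2) ^ 2) else 0

lemma pN_eq_max {N : ℝ} (hN : 0 < N) (x : ℝ) :
    pN N x = max (1 / (1 + x ^ 2) - 1 / (1 + (N / 2) ^ 2)) 0 := by
  unfold pN
  split_ifs with h
  · have hx : x ^ 2 ≤ (N / 2) ^ 2 := sq_le_sq' h.1 h.2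
    have : 1 / (1 + (N / 2) ^ 2) ≤ 1 / (1 + x ^ 2) := by gcongr
    rw [max_eq_left (by linarith)]
  · have hx : (N / 2) ^ 2 ≤ x ^ 2 := by
      rw [sq_le_sq, abs_of_pos (half_pos hN)]
      by_contra! hlt
      exact h ⟨(abs_lt.mp hlt).1.le, (abs_lt.mp hlt).2.le⟩
    have : 1 / (1 + x ^ 2) ≤ 1 / (1 + (N / 2) ^ 2) := by gcongr
    rw [max_eq_right (by linarith)]

lemma pN_nonneg {N : ℝ} (hN : 0 < N) (x : ℝ) : 0 ≤ pN N x := by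
  rw [pN_eq_max hN]
  exact le_max_right _ _

lemma continuous_pN {N : ℝ} (hN : 0 < N) : Continuous (pN N) := by
  rw [funext (pN_eq_max hN)]
  have h (x : ℝ) : 1 + x ^ 2 ≠ 0 := by positivity
  fun_prop (disch := exact h _)

lemma pN_neg (N x : ℝ) : pN N (-x) = pN N x := by
  have h : -x ∈ Icc (-(N / 2)) (N / 2) ↔ x ∈ Icc (-(N / 2)) (N / 2) := by
    constructor <;> rintro ⟨h₁, h₂⟩ <;> constructor <;> linarith
  simp only [pN, h, neg_sq]

lemma pN_eq_zero_of_le {N x : ℝ} (hN : 0 < N) (hx : x ≤ -(N / 2)) : pN N x = 0 := by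
  have h : (N / 2) ^ 2 ≤ x ^ 2 := by nlinarith
  have : 1 / (1 + x ^ 2) ≤ 1 / (1 + (N / 2) ^ 2) := by gcongr
  rw [pN_eq_max hN, max_eq_right (by linarith)]

lemma support_pN {N : ℝ} (hN : 0 < N) : Function.support (pN N) = Ioo (-(N / 2)) (N / 2) := by
  ext x
  rw [Function.mem_support]
  constructor
  · intro h
    constructor
    · by_contra! hx
      exact h (pN_eq_zero_of_le hN hx)
    · by_contra! hx
      exact h (by rw [← pN_neg]; exact pN_eq_zero_of_le hN (by linarith))
  · intro h
    have hx : x ^ 2 < (N / 2) ^ 2 := sq_lt_sq' h.1 h.2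
    have : 1 / (1 + (N / 2) ^ 2) < 1 / (1 + x ^ 2) := by gcongr
    rw [pN, if_pos (Ioo_subset_Icc_self h)]
    exact (sub_pos.mpr this).ne'

lemma tsupport_pN {N : ℝ} (hN : 0 < N) : tsupport (pN N) = Icc (-(N / 2)) (N / 2) := by
  rw [tsupport, support_pN hN, closure_Ioo (by linarith)]

lemma strictMonoOn_pN {N : ℝ} (hN : 0 < N) : StrictMonoOn (pN N) (Icc (-(N / 2)) 0) := by
  intro x hx y hy hxy
  have hsq : y ^ 2 < x ^ 2 := by nlinarith [hx.1, hy.2]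
  have : 1 / (1 + x ^ 2) < 1 / (1 + y ^ 2) := by gcongr
  rw [pN, pN, if_pos ⟨hx.1, by linarith [hx.2]⟩, if_pos ⟨hy.1, by linarith [hy.2]⟩]
  linarith

lemma two_div_one_add_sq_le {M x y : ℝ} (hM : 0 < M) (hM2 : 3 / 5 ≤ M ^ 2)
    (hxy : |x| ≤ 3 * y - 2 * M) (hx : |x| ≤ M / 3) :
    2 / (1 + y ^ 2) ≤ 1 / (1 + x ^ 2) + 1 / (1 + M ^ 2) := by
  have h0 := abs_nonneg x
  have hxsq : x ^ 2 ≤ (y - 2 * M / 3) * M := by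
    rw [← sq_abs]
    nlinarith
  have hx9 : x ^ 2 ≤ M ^ 2 / 9 := by
    rw [← sq_abs]
    nlinarith
  have hy : 4 * M ^ 2 / 9 ≤ y ^ 2 := by nlinarith
  have hcoef : 0 ≤ (y ^ 2 - 2 * x ^ 2) * (M ^ 2 - 3 / 5) :=
    mul_nonneg (by nlinarith) (by linarith)
  have hquad : 0 ≤ 13 * y ^ 2 - 11 * x ^ 2 - 5 * M ^ 2 := by
    nlinarith [sq_nonneg (26 * y - 11 * M), sq_nonneg M]
  have hxy2 : 0 ≤ x ^ 2 * y ^ 2 := by positivity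
  rw [div_add_div _ _ (by positivity) (by positivity),
    div_le_div_iff₀ (by positivity) (by positivity)]
  linarith

lemma Delta2_pN_nonneg {N a x : ℝ} (hN : 0 < N) (hN2 : 12 / 5 ≤ N ^ 2) (ha : N / 3 ≤ a)
    (ha' : a < 3 * N / 7) (hx : x ≤ -(N / 4) + 3 * a / 4) : 0 ≤ Delta2 a (pN N) x := by
  rw [Delta2, pN_eq_zero_of_le (x := x - 2 * a) hN (by linarith)]
  rcases le_total (x - a) (-(N / 2)) with h | h
  · rw [pN_eq_zero_of_le hN h]
    linarith [pN_nonneg hN x]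
  · have key : 2 / (1 + (a - x) ^ 2) ≤ 1 / (1 + x ^ 2) + 1 / (1 + (N / 2) ^ 2) :=
      two_div_one_add_sq_le (by linarith) (by linarith)
        (abs_le.mpr ⟨by linarith, by linarith⟩) (abs_le.mpr ⟨by linarith, by linarith⟩)
    have hsq : (x - a) ^ 2 = (a - x) ^ 2 := by ring
    have htwo : 2 / (1 + (a - x) ^ 2) = 2 * (1 / (1 + (a - x) ^ 2)) := by ring
    rw [pN, pN, if_pos ⟨by linarith, by linarith⟩, if_pos ⟨h, by linarith⟩, hsq]
    linarith

theorem stmt18 (N : ℝ) (hNbig : Real.sqrt (12 / 5) ≤ N) :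
    ∀ a : ℝ, N / 3 ≤ a → a < 3 * N / 7 →
      (∀ x ∈ Set.Icc (-(N / 2)) (-(N / 4) + 3 * a / 4), 0 ≤ Delta2 a (pN N) x) ∧
      memV N a (pN N) := by
  intro a ha ha'
  have hN : 0 < N := (Real.sqrt_pos.mpr (by norm_num)).trans_le hNbig
  have hN2 : 12 / 5 ≤ N ^ 2 := (Real.sqrt_le_left hN.le).mp hNbig
  have hD {x : ℝ} (hx : x ≤ -(N / 4) + 3 * a / 4) : 0 ≤ Delta2 a (pN N) x :=
    Delta2_pN_nonneg hN hN2 ha ha' hx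
  exact ⟨fun x hx => hD hx.2, continuous_pN hN, tsupport_pN hN, pN_neg N, strictMonoOn_pN hN,
    fun h => absurd h ha.not_gt,
    fun _ => ⟨fun x hx => hD (by linarith [hx.2]), hD le_rfl⟩⟩
end
end
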